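/- Let λ > 0, ρ ≥ 0, ω = √(λ+ρ), and let t₀ ≠ 0 be a real number; set s = ω·t₀. The following are equivalent: (1) there exists a pair of twice differentiable functions X¹, X² : ℝ → ℝ, not both identically zero, satisfying X¹'' − √λ·X²' = 0 and X²'' + √λ·X¹' + ρ·X² = 0 on ℝ, with X¹(0) = X²(0) = 0 and X¹(t₀) = X²(t₀) = 0; (2) sin(s/2)·( 2λ·sin(s/2) + ρ·s·cos(s/2) ) = 0, i.e. either s = 2pπ for some integer p, or tan(s/2) = −ρs/(2λ). -/

import Mathlib

theorem hs_aux (ω t : ℝ) : HasDerivAt (fun t => Real.sin (ω * t)) (ω * Real.cos (ω * t)) t := by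
  have h : HasDerivAt (fun t : ℝ => ω * t) ω t := by simpa using (hasDerivAt_id t).const_mul ω
  simpa [mul_comm] using h.sin

theorem hc_aux (ω t : ℝ) : HasDerivAt (fun t => Real.cos (ω * t)) (-(ω * Real.sin (ω * t))) t := by
  have h : HasDerivAt (fun t : ℝ => ω * t) ω t := by simpa using (hasDerivAt_id t).const_mul ω
  simpa [mul_comm] using h.cos

theorem const_aux (f : ℝ → ℝ) (h : ∀ t, HasDerivAt f 0 t) (t : ℝ) : f t = f 0 :=
  is_const_of_deriv_eq_zero (fun t => (h t).differentiableAt) (fun t => (h t).deriv) t 0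

theorem exist_aux (l r k ω a β : ℝ) (hk : k * k = l) (hω : ω * ω = l + r) (hω0 : ω ≠ 0)
    (hβ : β ≠ 0) (t₀ : ℝ)
    (e1 : a * (r * (ω * t₀) + l * Real.sin (ω * t₀)) + k * β * (1 - Real.cos (ω * t₀)) = 0)
    (e2 : -k * a * (1 - Real.cos (ω * t₀)) + β * Real.sin (ω * t₀) = 0) :
    ∃ X1 X2 : ℝ → ℝ,
      Differentiable ℝ X1 ∧ Differentiable ℝ (deriv X1) ∧
      Differentiable ℝ X2 ∧ Differentiable ℝ (deriv X2) ∧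
      ¬(X1 = (fun _ => 0) ∧ X2 = (fun _ => 0)) ∧
      (∀ t : ℝ, deriv (deriv X1) t - k * deriv X2 t = 0) ∧
      (∀ t : ℝ, deriv (deriv X2) t + k * deriv X1 t + r * X2 t = 0) ∧
      X1 0 = 0 ∧ X2 0 = 0 ∧ X1 t₀ = 0 ∧ X2 t₀ = 0 := by
  obtain ⟨X1, hX1⟩ : ∃ X : ℝ → ℝ, X = fun t => a * (r * (ω * t) + l * Real.sin (ω * t))
    + k * β * (1 - Real.cos (ω * t)) := ⟨_, rfl⟩
  obtain ⟨X2, hX2⟩ : ∃ X : ℝ → ℝ, X = fun t => ω * (-k * a * (1 - Real.cos (ω * t))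
    + β * Real.sin (ω * t)) := ⟨_, rfl⟩
  have d1 : ∀ t, HasDerivAt X1 (a * (r * ω + l * (ω * Real.cos (ω * t)))
      + k * β * (ω * Real.sin (ω * t))) t := by
    intro t
    rw [hX1]
    have h := (((((hasDerivAt_id t).const_mul ω).const_mul r).add
      ((hs_aux ω t).const_mul l)).const_mul a).add
      (((hc_aux ω t).const_sub 1).const_mul (k * β))
    refine HasDerivAt.congr_deriv h ?_
    ring
  have d2 : ∀ t, HasDerivAt X2 (ω * (-k * a * (ω * Real.sin (ω * t))
      + β * (ω * Real.cos (ω * t)))) t := by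
    intro t
    rw [hX2]
    have h := ((((hc_aux ω t).const_sub 1).const_mul (-k * a)).add
      ((hs_aux ω t).const_mul β)).const_mul ω
    refine HasDerivAt.congr_deriv h ?_
    ring
  have D1 := funext fun t => (d1 t).deriv
  have D2 := funext fun t => (d2 t).deriv
  have dd1 : ∀ t, HasDerivAt (deriv X1) (ω * ω * (-a * l * Real.sin (ω * t)
      + k * β * Real.cos (ω * t))) t := by
    intro t
    rw [D1]
    have h := (((((hc_aux ω t).const_mul ω).const_mul l).const_add (r * ω)).const_mul a).add
      (((hs_aux ω t).const_mul ω).const_mul (k * β))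
    refine HasDerivAt.congr_deriv h ?_
    ring
  have dd2 : ∀ t, HasDerivAt (deriv X2) (ω * (ω * ω) * (-k * a * Real.cos (ω * t)
      - β * Real.sin (ω * t))) t := by
    intro t
    rw [D2]
    have h := ((((hs_aux ω t).const_mul ω).const_mul (-k * a)).add
      (((hc_aux ω t).const_mul ω).const_mul β)).const_mul ω
    refine HasDerivAt.congr_deriv h ?_
    ring
  refine ⟨X1, X2, fun t => (d1 t).differentiableAt, fun t => (dd1 t).differentiableAt,
    fun t => (d2 t).differentiableAt, fun t => (dd2 t).differentiableAt, ?_, ?_, ?_, ?_, ?_, ?_, ?_⟩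
  · rintro ⟨-, h⟩
    have h0 := (d2 0).deriv
    rw [h] at h0
    simp [hω0, hβ] at h0
  · intro t
    rw [(dd1 t).deriv, (d2 t).deriv, ← hk]
    ring
  · intro t
    rw [(dd2 t).deriv, (d1 t).deriv, hX2, hω, ← hk]
    ring
  · simp [hX1]
  · simp [hX2]
  · simp only [hX1]; exact e1
  · simp only [hX2]; rw [e2, mul_zero]

theorem uniq_aux (l r k ω : ℝ) (hk : k * k = l) (hω : ω * ω = l + r) (hω0 : ω ≠ 0)
    (X1 X2 : ℝ → ℝ) (h1 : Differentiable ℝ X1) (h1' : Differentiable ℝ (deriv X1))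
    (h2 : Differentiable ℝ X2) (h2' : Differentiable ℝ (deriv X2))
    (e1 : ∀ t : ℝ, deriv (deriv X1) t - k * deriv X2 t = 0)
    (e2 : ∀ t : ℝ, deriv (deriv X2) t + k * deriv X1 t + r * X2 t = 0)
    (z1 : X1 0 = 0) (z2 : X2 0 = 0) :
    ∃ a β : ℝ, ∀ t, ω * (ω * ω) * X1 t = a * (r * (ω * t) + l * Real.sin (ω * t))
        + k * β * (1 - Real.cos (ω * t)) ∧
      ω * ω * X2 t = -k * a * (1 - Real.cos (ω * t)) + β * Real.sin (ω * t) := by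
  have H1 := fun t => (h1 t).hasDerivAt
  have H2 := fun t => (h2 t).hasDerivAt
  have H1' := fun t => (h1' t).hasDerivAt
  have H2' := fun t => (h2' t).hasDerivAt
  obtain ⟨a, ha⟩ : ∃ a, a = deriv X1 0 := ⟨_, rfl⟩
  obtain ⟨b, hb⟩ : ∃ b, b = deriv X2 0 := ⟨_, rfl⟩
  have P : ∀ t, deriv X1 t = a + k * X2 t := by
    intro t
    have := const_aux (fun t => deriv X1 t - k * X2 t) (fun t => by
      have h := (H1' t).sub ((H2 t).const_mul k)
      rw [e1 t] at h
      exact h) t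
    simp only [z2, ← ha] at this
    linarith
  have Q1 : ∀ t, (ω * ω * X2 t + k * a) * Real.cos (ω * t) - ω * deriv X2 t * Real.sin (ω * t)
      = k * a := by
    intro t
    have := const_aux (fun t => (ω * ω * X2 t + k * a) * Real.cos (ω * t)
        - ω * deriv X2 t * Real.sin (ω * t)) (fun t => by
      have h := ((((H2 t).const_mul (ω * ω)).add_const (k * a)).mul (hc_aux ω t)).sub
        (((H2' t).const_mul ω).mul (hs_aux ω t))
      refine HasDerivAt.congr_deriv h ?_
      have := e2 t
      rw [P t] at this
      linear_combination -(ω * Real.sin (ω * t)) * this - ω * Real.sin (ω * t) * X2 t * (hω - hk)) t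
    simpa [z2] using this
  have Q2 : ∀ t, (ω * ω * X2 t + k * a) * Real.sin (ω * t) + ω * deriv X2 t * Real.cos (ω * t)
      = ω * b := by
    intro t
    have := const_aux (fun t => (ω * ω * X2 t + k * a) * Real.sin (ω * t)
        + ω * deriv X2 t * Real.cos (ω * t)) (fun t => by
      have h := ((((H2 t).const_mul (ω * ω)).add_const (k * a)).mul (hs_aux ω t)).add
        (((H2' t).const_mul ω).mul (hc_aux ω t))
      refine HasDerivAt.congr_deriv h ?_
      have := e2 t
      rw [P t] at this
      linear_combination (ω * Real.cos (ω * t)) * this + ω * Real.cos (ω * t) * X2 t * (hω - hk)) t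
    simpa [z2, ← hb] using this
  have R : ∀ t, ω * ω * X2 t = -k * a * (1 - Real.cos (ω * t)) + ω * b * Real.sin (ω * t) := by
    intro t
    linear_combination Real.cos (ω * t) * Q1 t + Real.sin (ω * t) * Q2 t
      - (ω * ω * X2 t + k * a) * Real.sin_sq_add_cos_sq (ω * t)
  refine ⟨a, ω * b, fun t => ⟨?_, R t⟩⟩
  have := const_aux (fun t => ω * (ω * ω) * X1 t - (a * (r * (ω * t) + l * Real.sin (ω * t))
        + k * (ω * b) * (1 - Real.cos (ω * t)))) (fun t => by
      have h := ((H1 t).const_mul (ω * (ω * ω))).sub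
        ((((((hasDerivAt_id t).const_mul ω).const_mul r).add
        ((hs_aux ω t).const_mul l)).const_mul a).add
        (((hc_aux ω t).const_sub 1).const_mul (k * (ω * b))))
      refine HasDerivAt.congr_deriv h ?_
      rw [P t]
      linear_combination (ω * k) * R t + ω * a * hω
        - ω * a * (1 - Real.cos (ω * t)) * hk) t
  simp [z1] at this
  linarith

/-- Analytic criterion for a conjugate point at parameter `t₀`.
Let `l > 0`, `r ≥ 0`, `ω = √(l+r)`, `t₀ ≠ 0`, `s = ω·t₀`.  There exists a nontrivial
solution `(X¹, X²)` of the system `X¹'' − √l·X²' = 0`, `X²'' + √l·X¹' + r·X² = 0`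
vanishing (in both components) at `0` and at `t₀` if and only if
`sin(s/2)·(2l·sin(s/2) + r·s·cos(s/2)) = 0` (i.e. either `s = 2pπ` for some integer
`p`, or `tan(s/2) = −rs/(2l)`). -/
theorem stmt8
    (l r : ℝ) (hl : 0 < l) (hr : 0 ≤ r)
    (ω : ℝ) (hω : ω = Real.sqrt (l + r))
    (t₀ : ℝ) (ht₀ : t₀ ≠ 0)
    (s : ℝ) (hs : s = ω * t₀) :
    (∃ X1 X2 : ℝ → ℝ,
      Differentiable ℝ X1 ∧ Differentiable ℝ (deriv X1) ∧
      Differentiable ℝ X2 ∧ Differentiable ℝ (deriv X2) ∧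
      ¬(X1 = (fun _ => 0) ∧ X2 = (fun _ => 0)) ∧
      (∀ t : ℝ, deriv (deriv X1) t - Real.sqrt l * deriv X2 t = 0) ∧
      (∀ t : ℝ, deriv (deriv X2) t + Real.sqrt l * deriv X1 t + r * X2 t = 0) ∧
      X1 0 = 0 ∧ X2 0 = 0 ∧ X1 t₀ = 0 ∧ X2 t₀ = 0) ↔
    Real.sin (s / 2) * (2 * l * Real.sin (s / 2) + r * s * Real.cos (s / 2)) = 0 := by
  have hk : Real.sqrt l * Real.sqrt l = l := Real.mul_self_sqrt hl.le
  have hω2 : ω * ω = l + r := by rw [hω]; exact Real.mul_self_sqrt (by linarith)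
  have hω0 : ω ≠ 0 := by
    rintro rfl
    linarith
  have hsin : Real.sin (ω * t₀) = 2 * Real.sin (s / 2) * Real.cos (s / 2) := by
    rw [← Real.sin_two_mul, ← hs]; congr 1; ring
  have hcos : Real.cos (ω * t₀) = 1 - 2 * Real.sin (s / 2) ^ 2 := by
    have h : ω * t₀ = 2 * (s / 2) := by rw [← hs]; ring
    rw [h, Real.cos_two_mul]
    linarith [Real.sin_sq_add_cos_sq (s / 2)]
  have hSC := Real.sin_sq_add_cos_sq (s / 2)
  generalize Real.sqrt l = k at *
  generalize Real.sin (s / 2) = S at *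
  generalize Real.cos (s / 2) = C at *
  constructor
  · rintro ⟨X1, X2, h1, h1', h2, h2', hn, e1, e2, z1, z2, w1, w2⟩
    obtain ⟨a, β, h⟩ := uniq_aux l r k ω hk hω2 hω0 X1 X2 h1 h1' h2 h2' e1 e2 z1 z2
    obtain ⟨E1, E2⟩ := h t₀
    rw [w1, hsin, hcos, ← hs] at E1
    rw [w2, hsin, hcos] at E2
    have ha : a * (S * (2 * l * S + r * s * C)) = 0 := by
      linear_combination -(S * C) * E1 + k * S ^ 2 * E2 - 2 * a * S ^ 4 * hk
        - 2 * a * l * S ^ 2 * hSC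
    have hb : β * (S * (2 * l * S + r * s * C)) = 0 := by
      linear_combination -(r * s + 2 * l * S * C) / 2 * E2 - k * S ^ 2 * E1
        - 2 * β * S ^ 4 * hk - 2 * β * l * S ^ 2 * hSC
    rcases mul_eq_zero.1 ha with ha | ha
    · rcases mul_eq_zero.1 hb with hb | hb
      · exfalso
        apply hn
        constructor
        · funext t
          have := (h t).1
          simpa [ha, hb, hω0] using this
        · funext t
          have := (h t).2
          simpa [ha, hb, hω0] using this
      · exact hb
    · exact ha
  · intro h
    by_cases hS : S = 0
    · refine exist_aux l r k ω 0 1 hk hω2 hω0 one_ne_zero t₀ ?_ ?_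
      · rw [hcos, hS]; ring
      · rw [hcos, hsin, hS]; ring
    · have hD := (mul_eq_zero.1 h).resolve_left hS
      have hk0 : k ≠ 0 := by
        rintro rfl
        linarith
      refine exist_aux l r k ω C (k * S) hk hω2 hω0 (mul_ne_zero hk0 hS) t₀ ?_ ?_
      · rw [hcos, hsin, ← hs]
        linear_combination hD + 2 * S ^ 3 * hk + 2 * l * S * hSC
      · rw [hcos, hsin]; ring
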